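/- For the uniform input distribution U on {0,1} and any binary channel W with capacity C(W) > 0, the ratio I(U,W)/C(W) is at least some constant α₀ > 0.94; equivalently, I(U,W) ≥ 0.94 · C(W) for every binary channel W. (Majani–Rumsey / Shulman–Feder bound, weakened to the constant 0.94.) -/

import Mathlib

open Finset Real

/-- The binary channel with parameters `(a,b)`: `ch a b x y = W(y|x)`,
with `W(0|0) = a`, `W(1|1) = b`. -/
noncomputable def ch (a b : ℝ) : Fin 2 → Fin 2 → ℝ := fun x y =>
  if x = 0 then (if y = 0 then a else 1 - a) else (if y = 0 then 1 - b else b)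

/-- Mutual information (in bits) `I(P, W)` for the input distribution
`P(0) = q`, `P(1) = 1 - q`, with the convention `0 · log 0 = 0`. -/
noncomputable def mi2 (q a b : ℝ) : ℝ :=
  ∑ x, ∑ y, (if x = 0 then q else 1 - q) * ch a b x y *
    Real.logb 2 (ch a b x y / (q * ch a b 0 y + (1 - q) * ch a b 1 y))

/-- The capacity (in bits) of the binary channel `(a,b)`. -/
noncomputable def capacity (a b : ℝ) : ℝ :=
  sSup {r : ℝ | ∃ q ∈ Set.Icc (0:ℝ) 1, r = mi2 q a b}

/-- Contribution of a single output letter to the mutual information (in nats). -/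
noncomputable def gfun (q u v : ℝ) : ℝ :=
  q * (u * log u) + (1 - q) * (v * log v)
    - (q * u + (1 - q) * v) * log (q * u + (1 - q) * v)

/-- The difference function on the normalized segment. -/
noncomputable def Ffun (q t : ℝ) : ℝ := gfun (1/2) t (1 - t) - 0.94 * gfun q t (1 - t)

/-- First derivative of `Ffun`. -/
noncomputable def Ffun' (q t : ℝ) : ℝ :=
  1/2 * (log t - log (1 - t))
    - 0.94 * (q * log t - (1 - q) * log (1 - t) + (1 - 2 * q) * log (q * t + (1 - q) * (1 - t)))

/-- Second derivative of `Ffun`. -/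
noncomputable def Ffun'' (q t : ℝ) : ℝ :=
  ((q * t + (1 - q) * (1 - t)) - 2 * 0.94 * q * (1 - q)) /
    (2 * t * (1 - t) * (q * t + (1 - q) * (1 - t)))

lemma Ffun_cont (q : ℝ) : Continuous (Ffun q) := by
  have h := Real.continuous_mul_log
  have h1 : Continuous fun t : ℝ => (1 - t) * log (1 - t) :=
    h.comp (continuous_const.sub continuous_id)
  have h2 : ∀ p : ℝ, Continuous fun t : ℝ =>
      (p * t + (1 - p) * (1 - t)) * log (p * t + (1 - p) * (1 - t)) := fun p =>
    h.comp (by fun_prop : Continuous fun t : ℝ => p * t + (1 - p) * (1 - t))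
  have h3 : ∀ p : ℝ, Continuous fun t : ℝ => gfun p t (1 - t) := fun p =>
    ((continuous_const.mul h).add (continuous_const.mul h1)).sub (h2 p)
  exact (h3 _).sub (continuous_const.mul (h3 q))

lemma gfun_deriv (q t : ℝ) (h0 : t ≠ 0) (h1 : 1 - t ≠ 0) (hm : q * t + (1 - q) * (1 - t) ≠ 0) :
    HasDerivAt (fun t => gfun q t (1 - t))
      (q * log t - (1 - q) * log (1 - t) + (1 - 2 * q) * log (q * t + (1 - q) * (1 - t))) t := by
  have e1 := Real.hasDerivAt_mul_log h0
  have d1 : HasDerivAt (fun t : ℝ => 1 - t) (-1) t := by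
    simpa using (hasDerivAt_id t).const_sub 1
  have e2 := (Real.hasDerivAt_mul_log h1).comp t d1
  have d2 : HasDerivAt (fun t : ℝ => q * t + (1 - q) * (1 - t)) (q * 1 + (1 - q) * (-1)) t :=
    ((hasDerivAt_id t).const_mul q).add (d1.const_mul (1 - q))
  have e3 := (Real.hasDerivAt_mul_log hm).comp t d2
  have := ((e1.const_mul q).add (e2.const_mul (1 - q))).sub e3
  refine HasDerivAt.congr_deriv this ?_
  ring

lemma Ffun_deriv (q t : ℝ) (h0 : 0 < t) (h1 : t < 1) (hm : 0 < q * t + (1 - q) * (1 - t)) :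
    HasDerivAt (Ffun q) (Ffun' q t) t := by
  have e1 := gfun_deriv (1/2) t h0.ne' (by linarith) (by norm_num; linarith)
  have e2 := gfun_deriv q t h0.ne' (by linarith) hm.ne'
  have := e1.sub (e2.const_mul 0.94)
  refine HasDerivAt.congr_deriv this ?_
  unfold Ffun'
  ring

lemma Ffun_deriv2 (q t : ℝ) (h0 : 0 < t) (h1 : t < 1) (hm : 0 < q * t + (1 - q) * (1 - t)) :
    HasDerivAt (Ffun' q) (Ffun'' q t) t := by
  have h1' : 0 < 1 - t := by linarith
  have e1 := Real.hasDerivAt_log h0.ne'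
  have d1 : HasDerivAt (fun t : ℝ => 1 - t) (-1) t := by
    simpa using (hasDerivAt_id t).const_sub 1
  have e2 := d1.log h1'.ne'
  have d2 : HasDerivAt (fun t : ℝ => q * t + (1 - q) * (1 - t)) (q * 1 + (1 - q) * (-1)) t :=
    ((hasDerivAt_id t).const_mul q).add (d1.const_mul (1 - q))
  have e3 := d2.log hm.ne'
  have := ((e1.sub e2).const_mul (1/2)).sub
    ((((e1.const_mul q).sub (e2.const_mul (1 - q))).add (e3.const_mul (1 - 2 * q))).const_mul 0.94)
  refine HasDerivAt.congr_deriv this ?_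
  unfold Ffun''
  set m := q * t + (1 - q) * (1 - t) with hmd
  have hm' := hm.ne'
  have h0' := h0.ne'
  have h1'' := h1'.ne'
  field_simp
  rw [hmd]
  ring

lemma Ffun_one (q : ℝ) (hq : 0 ≤ q) : 0 ≤ Ffun q 1 := by
  have key : -(q * log q) ≤ 1 / exp 1 := by
    rcases hq.eq_or_lt with h | h
    · rw [← h]; simp; positivity
    · have he := exp_pos 1
      have := Real.log_le_sub_one_of_pos (show 0 < 1 / (exp 1 * q) by positivity)
      rw [Real.log_div one_ne_zero (by positivity), Real.log_mul he.ne' h.ne', Real.log_exp,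
        Real.log_one] at this
      have h2 : -log q ≤ 1 / (exp 1 * q) := by linarith
      have h3 := mul_le_mul_of_nonneg_left h2 hq
      have h4 : q * (1 / (exp 1 * q)) = 1 / exp 1 := by field_simp
      linarith
  have he : 1 / exp 1 ≤ 1 / 2.718 :=
    one_div_le_one_div_of_le (by norm_num) (by have := exp_one_gt_d9; linarith)
  have hl := log_two_gt_d9
  have : Ffun q 1 = 1/2 * log 2 + 0.94 * (q * log q) := by
    have : log (1/2) = - log 2 := by rw [one_div, Real.log_inv]
    simp only [Ffun, gfun, sub_self, mul_zero, add_zero, log_one, mul_one, zero_mul, this]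
    ring
  rw [this]
  norm_num at he hl key ⊢
  linarith

lemma Ffun_nonneg (q t : ℝ) (hq : 0 ≤ q) (hq2 : q ≤ 1/2) (ht : 0 ≤ t) (ht1 : t ≤ 1) :
    0 ≤ Ffun q t := by
  have hm : ∀ x : ℝ, 0 < x → x < 1 → 0 < q * x + (1 - q) * (1 - x) := fun x hx hx1 => by
    nlinarith [mul_nonneg hq hx.le]
  have half : Ffun q (1/2) = 0 := by
    have : q * (1/2) + (1 - q) * (1 - 1/2) = 1/2 := by ring
    simp only [Ffun, gfun, this]
    norm_num
    ring
  have half' : Ffun' q (1/2) = 0 := by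
    have : q * (1/2) + (1 - q) * (1 - 1/2) = 1/2 := by ring
    simp only [Ffun', this]
    norm_num
    ring
  have conv : ∀ s, 1/2 ≤ s → s ≤ 1 → (∀ x, x < s → 2 * 0.94 * q * (1 - q) ≤
      q * x + (1 - q) * (1 - x)) → ∀ x, 0 ≤ x → x ≤ s → 0 ≤ Ffun q x := by
    intro s hs hs1 H x hx hxs
    have C : ConvexOn ℝ (Set.Icc 0 s) (Ffun q) := by
      refine convexOn_of_hasDerivWithinAt2_nonneg (convex_Icc _ _) (Ffun_cont q).continuousOn
        (f' := Ffun' q) (f'' := Ffun'' q) ?_ ?_ ?_ <;> rw [interior_Icc] <;> rintro y ⟨hy, hys⟩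
      · exact (Ffun_deriv q y hy (by linarith) (hm y hy (by linarith))).hasDerivWithinAt
      · exact (Ffun_deriv2 q y hy (by linarith) (hm y hy (by linarith))).hasDerivWithinAt
      · have h1 := hm y hy (by linarith)
        have h2 : 0 < 1 - y := by linarith
        have h3 := H y hys
        exact div_nonneg (by linarith) (by positivity)
    have D := Ffun_deriv q (1/2) (by norm_num) (by norm_num) (hm _ (by norm_num) (by norm_num))
    rw [half'] at D
    rcases lt_trichotomy x (1/2) with h | h | h
    · have := C.slope_le_of_hasDerivAt ⟨hx, hxs⟩ ⟨by norm_num, hs⟩ h D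
      rw [slope_def_field, half, div_le_iff₀ (by linarith)] at this
      linarith
    · rw [h, half]
    · have := C.le_slope_of_hasDerivAt ⟨by norm_num, hs⟩ ⟨hx, hxs⟩ h D
      rw [slope_def_field, half, le_div_iff₀ (by linarith)] at this
      linarith
  by_cases hc : 2 * 0.94 * q * (1 - q) ≤ q
  · refine conv 1 (by norm_num) le_rfl (fun x hx => ?_) t ht ht1
    nlinarith
  · push Not at hc
    have hq3 : 0 < 1 - 2 * q := by
      by_contra hcon
      have : q = 1/2 := by linarith
      rw [this] at hc
      norm_num at hc
    set s := ((1 - q) - 2 * 0.94 * q * (1 - q)) / (1 - 2 * q) with hs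
    have hs' : s * (1 - 2 * q) = (1 - q) - 2 * 0.94 * q * (1 - q) := by
      rw [hs, div_mul_cancel₀ _ hq3.ne']
    have s1 : s ≤ 1 := by
      rw [hs, div_le_one hq3]; linarith
    have s2 : 1/2 ≤ s := by
      rw [hs, le_div_iff₀ hq3]; nlinarith [sq_nonneg (1 - 2 * q)]
    have A := conv s s2 s1 (fun x hx => by nlinarith)
    rcases le_total t s with h | h
    · exact A t ht h
    · have C : ConcaveOn ℝ (Set.Icc s 1) (Ffun q) := by
        refine concaveOn_of_hasDerivWithinAt2_nonpos (convex_Icc _ _) (Ffun_cont q).continuousOn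
          (f' := Ffun' q) (f'' := Ffun'' q) ?_ ?_ ?_ <;> rw [interior_Icc] <;> rintro y ⟨hy, hys⟩
        · exact (Ffun_deriv q y (by linarith) (by linarith)
            (hm y (by linarith) (by linarith))).hasDerivWithinAt
        · exact (Ffun_deriv2 q y (by linarith) (by linarith)
            (hm y (by linarith) (by linarith))).hasDerivWithinAt
        · have h0 : 0 < y := by linarith
          have h1 := hm y h0 (by linarith)
          have h2 : 0 < 1 - y := by linarith
          exact div_nonpos_of_nonpos_of_nonneg (by nlinarith) (by positivity)
      have := C.min_le_of_mem_Icc ⟨le_rfl, s1⟩ ⟨s1, le_rfl⟩ ⟨h, ht1⟩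
      exact le_trans (le_min (A s (by linarith) le_rfl) (Ffun_one q hq)) this

lemma gfun_symm (q u v : ℝ) : gfun q u v = gfun (1 - q) v u := by
  have : (1 - q) * v + (1 - (1 - q)) * u = q * u + (1 - q) * v := by ring
  simp only [gfun, this]
  ring

lemma gfun_smul (q s u v : ℝ) (hs : 0 < s) : gfun q (s * u) (s * v) = s * gfun q u v := by
  have L : ∀ x, (s * x) * log (s * x) = s * (x * log x) + s * log s * x := by
    intro x
    by_cases hx : x = 0
    · simp [hx]
    · rw [Real.log_mul hs.ne' hx]; ring
  have e : q * (s * u) + (1 - q) * (s * v) = s * (q * u + (1 - q) * v) := by ring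
  unfold gfun
  rw [e, L, L, L]
  ring

lemma gfun_le (q u v : ℝ) (hq : 0 ≤ q) (hq1 : q ≤ 1) (hu : 0 ≤ u) (hv : 0 ≤ v) :
    0.94 * gfun q u v ≤ gfun (1/2) u v := by
  wlog h : q ≤ 1/2 generalizing q u v
  · have := this (1 - q) v u (by linarith) (by linarith) hv hu (by linarith)
    rw [gfun_symm q u v, gfun_symm (1/2) u v]
    norm_num at this ⊢
    exact this
  rcases (add_nonneg hu hv).eq_or_lt with h0 | h0
  · have hu0 : u = 0 := by linarith
    have hv0 : v = 0 := by linarith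
    simp [gfun, hu0, hv0]
  · have hF := Ffun_nonneg q (u / (u + v)) hq h (by positivity)
      ((div_le_one h0).2 (by linarith))
    have e1 : (u + v) * (u / (u + v)) = u := by field_simp
    have e2 : (u + v) * (1 - u / (u + v)) = v := by field_simp; ring
    have g := fun p => gfun_smul p (u + v) (u / (u + v)) (1 - u / (u + v)) h0
    simp only [e1, e2] at g
    rw [g, g]
    unfold Ffun at hF
    nlinarith

lemma term_eq (q u v : ℝ) (hq : 0 ≤ q) (hq1 : q ≤ 1) (hu : 0 ≤ u) (hv : 0 ≤ v) :
    q * u * logb 2 (u / (q * u + (1 - q) * v)) + (1 - q) * v * logb 2 (v / (q * u + (1 - q) * v))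
      = gfun q u v / log 2 := by
  have hq' : 0 ≤ 1 - q := by linarith
  have a1 := mul_nonneg hq hu
  have a2 := mul_nonneg hq' hv
  have A : q * u * log (u / (q * u + (1 - q) * v))
      = q * u * (log u - log (q * u + (1 - q) * v)) := by
    rcases a1.eq_or_lt with h | h
    · rw [← h]; simp
    · rw [Real.log_div (by rintro rfl; simp at h) (by linarith)]
  have B : (1 - q) * v * log (v / (q * u + (1 - q) * v))
      = (1 - q) * v * (log v - log (q * u + (1 - q) * v)) := by
    rcases a2.eq_or_lt with h | h
    · rw [← h]; simp
    · rw [Real.log_div (by rintro rfl; simp at h) (by linarith)]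
  unfold Real.logb
  rw [← mul_div_assoc, ← mul_div_assoc, A, B, ← add_div]
  congr 1
  unfold gfun
  ring

lemma mi2_eq (q a b : ℝ) (hq : q ∈ Set.Icc (0:ℝ) 1)
    (ha : a ∈ Set.Icc (0:ℝ) 1) (hb : b ∈ Set.Icc (0:ℝ) 1) :
    mi2 q a b = (gfun q a (1 - b) + gfun q (1 - a) b) / log 2 := by
  obtain ⟨hq0, hq1⟩ := hq
  obtain ⟨ha0, ha1⟩ := ha
  obtain ⟨hb0, hb1⟩ := hb
  rw [add_div, ← term_eq q a (1 - b) hq0 hq1 ha0 (by linarith),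
    ← term_eq q (1 - a) b hq0 hq1 (by linarith) hb0]
  simp [mi2, ch, Fin.sum_univ_two]
  ring

/-- Majani–Rumsey / Shulman–Feder bound (weakened to the constant `0.94`):
the uniform input distribution achieves at least `94%` of the capacity of
every binary memoryless channel. -/
theorem stmt_11 (a b : ℝ) (ha : a ∈ Set.Icc (0:ℝ) 1) (hb : b ∈ Set.Icc (0:ℝ) 1) :
    0.94 * capacity a b ≤ mi2 (1/2) a b := by
  have hl : 0 < log 2 := Real.log_pos (by norm_num)
  have key : capacity a b ≤ mi2 (1/2) a b / 0.94 := by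
    refine csSup_le ⟨_, 0, by simp, rfl⟩ ?_
    rintro r ⟨q, hq, rfl⟩
    rw [le_div_iff₀ (by norm_num), mi2_eq q a b hq ha hb,
      mi2_eq (1/2) a b (by constructor <;> norm_num) ha hb, div_mul_eq_mul_div]
    apply div_le_div_of_nonneg_right _ hl.le
    have h1 := gfun_le q a (1 - b) hq.1 hq.2 ha.1 (by linarith [hb.2])
    have h2 := gfun_le q (1 - a) b hq.1 hq.2 (by linarith [ha.2]) hb.1
    linarith
  rw [le_div_iff₀ (by norm_num)] at key
  linarith
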